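/- There is an absolute constant c₀ ≥ 1 such that for every real c ≥ c₀ there is a constant C = C(c) > 0 with: for every integer m ≥ 16, every integer n ≤ m with ε := 1 − n/m satisfying 0 < ε ≤ 1/c, and every array configuration A on m slots with n elements, Σ_{j ∈ J} Δ_j(A)² ≤ C·ε². -/

import Mathlib

open scoped BigOperators Classical

/-- Read slot `i` (mod `m`) of a cyclic array of `m` boolean slots. -/
def cyc (m : ℕ) (A : Fin m → Bool) (i : ℕ) : Bool :=
  if h : 0 < m then A ⟨i % m, Nat.mod_lt i h⟩ else false

/-- Number of occupied slots among the `j` cyclically consecutive slots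
`p, p+1, …, p+j-1`. -/
def blockCount (m : ℕ) (A : Fin m → Bool) (p j : ℕ) : ℕ :=
  ((Finset.range j).filter (fun t => cyc m A (p + t) = true)).card

/-- Density of the `j`-block starting at slot `p`. -/
noncomputable def blockDensity (m : ℕ) (A : Fin m → Bool) (p j : ℕ) : ℝ :=
  (blockCount m A p j : ℝ) / j

/-- A block is live (w.r.t. constant `c` and sparsity `ε`) if its density is
at least `1 - c·ε`. -/
def IsLive (c ε : ℝ) (m : ℕ) (A : Fin m → Bool) (p j : ℕ) : Prop :=
  1 - c * ε ≤ blockDensity m A p j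

/-- Imbalance of a `j`-block (for even `j`): difference of the densities of its
two halves. -/
noncomputable def imbalance (m : ℕ) (A : Fin m → Bool) (p j : ℕ) : ℝ :=
  |blockDensity m A p (j / 2) - blockDensity m A (p + j / 2) (j / 2)|

/-- Adjusted imbalance: the imbalance if the block is live, `0` if it is dead. -/
noncomputable def adjImbalance (c ε : ℝ) (m : ℕ) (A : Fin m → Bool) (p j : ℕ) : ℝ :=
  if IsLive c ε m A p j then imbalance m A p j else 0

/-- `Δ_j(A)`: the average adjusted imbalance over all `m` `j`-blocks. -/
noncomputable def DeltaAvg (c ε : ℝ) (m : ℕ) (A : Fin m → Bool) (j : ℕ) : ℝ :=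
  (∑ p ∈ Finset.range m, adjImbalance c ε m A p j) / m

/-- `J = {2, 4, 8, …, 2^(⌊log₂ m⌋ - 2)}`. -/
def Jset (m : ℕ) : Finset ℕ := (Finset.Icc 1 (Nat.log 2 m - 2)).image (fun i => 2 ^ i)

/-- The potential `φ` of a `j`-block: `0` if dead, `(μ - (1 - c·ε))²` if live,
where `μ` is its density. -/
noncomputable def potential (c ε : ℝ) (m : ℕ) (A : Fin m → Bool) (p j : ℕ) : ℝ :=
  if IsLive c ε m A p j then (blockDensity m A p j - (1 - c * ε)) ^ 2 else 0

theorem aux_cyc (m : ℕ) (A : Fin m → Bool) (i : ℕ) : cyc m A (i + m) = cyc m A i := by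
  unfold cyc
  simp

theorem aux_count_per (m : ℕ) (A : Fin m → Bool) (p j : ℕ) :
    blockCount m A (p + m) j = blockCount m A p j := by
  unfold blockCount
  congr 1
  apply Finset.filter_congr
  intro t _
  rw [show p + m + t = (p + t) + m by omega, aux_cyc]

theorem aux_count_add (m : ℕ) (A : Fin m → Bool) (p h : ℕ) :
    blockCount m A p (h + h) = blockCount m A p h + blockCount m A (p + h) h := by
  unfold blockCount
  simp only [Finset.card_filter]
  rw [Finset.sum_range_add]
  simp only [add_assoc]

theorem aux_shift (m : ℕ) (F : ℕ → ℝ) (hF : ∀ p, F (p + m) = F p) (h : ℕ) :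
    ∑ p ∈ Finset.range m, F (p + h) = ∑ p ∈ Finset.range m, F p := by
  induction h with
  | zero => simp
  | succ h ih =>
    rw [← ih]
    have h1 := Finset.sum_range_succ (fun p => F (p + h)) m
    have h2 := Finset.sum_range_succ' (fun p => F (p + h)) m
    have h3 : F (m + h) = F (0 + h) := by rw [zero_add, add_comm]; exact hF h
    have h4 : ∑ p ∈ Finset.range m, F (p + (h + 1)) = ∑ p ∈ Finset.range m, F (p + 1 + h) := by
      apply Finset.sum_congr rfl
      intro p _
      congr 1
      omega
    rw [h4]
    linarith

theorem aux_gain (c ε : ℝ) (m : ℕ) (A : Fin m → Bool) (p h : ℕ) (hh : 0 < h) :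
    (adjImbalance c ε m A p (h + h)) ^ 2 / 16 ≤
      (potential c ε m A p h + potential c ε m A (p + h) h) / 2 - potential c ε m A p (h + h) := by
  have hd : blockDensity m A p (h + h) =
      (blockDensity m A p h + blockDensity m A (p + h) h) / 2 := by
    unfold blockDensity
    rw [aux_count_add]
    have : (h : ℝ) ≠ 0 := by positivity
    push_cast
    field_simp
    ring
  unfold adjImbalance potential imbalance IsLive
  rw [hd, show (h + h) / 2 = h by omega]
  generalize blockDensity m A p h = a
  generalize blockDensity m A (p + h) h = b
  generalize 1 - c * ε = t
  split_ifs with h1 h2 h3 h3 <;> (try simp only [sq_abs])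
  · nlinarith [sq_nonneg (a - b)]
  · nlinarith [mul_nonneg (show 0 ≤ a + b - 2 * t by linarith) (show 0 ≤ t - b by linarith),
      mul_nonneg (show 0 ≤ a + b - 2 * t by linarith) (show 0 ≤ a - t by linarith),
      sq_nonneg (a + b - 2 * t)]
  · nlinarith [mul_nonneg (show 0 ≤ a + b - 2 * t by linarith) (show 0 ≤ t - a by linarith),
      mul_nonneg (show 0 ≤ a + b - 2 * t by linarith) (show 0 ≤ b - t by linarith),
      sq_nonneg (a + b - 2 * t)]
  · linarith
  all_goals nlinarith [sq_nonneg (a - t), sq_nonneg (b - t)]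

theorem aux_pot_nonneg (c ε : ℝ) (m : ℕ) (A : Fin m → Bool) (p j : ℕ) :
    0 ≤ potential c ε m A p j := by
  unfold potential
  split_ifs <;> positivity

theorem aux_pot_le (c ε : ℝ) (m : ℕ) (A : Fin m → Bool) (p : ℕ) :
    potential c ε m A p 1 ≤ (c * ε) ^ 2 := by
  unfold potential IsLive
  have h1 : blockDensity m A p 1 ≤ 1 := by
    unfold blockDensity
    have : blockCount m A p 1 ≤ 1 := by
      unfold blockCount
      exact (Finset.card_filter_le _ _).trans (by simp)
    have : (blockCount m A p 1 : ℝ) ≤ 1 := by exact_mod_cast this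
    simpa using this
  split_ifs with h
  · apply pow_le_pow_left₀ <;> linarith
  · positivity

theorem aux_step (c ε : ℝ) (m : ℕ) (hm : 0 < m) (A : Fin m → Bool) (h : ℕ) (hh : 0 < h) :
    (DeltaAvg c ε m A (h + h)) ^ 2 ≤
      16 * (∑ p ∈ Finset.range m, potential c ε m A p h) / m
        - 16 * (∑ p ∈ Finset.range m, potential c ε m A p (h + h)) / m := by
  have hm' : (0 : ℝ) < m := by exact_mod_cast hm
  have e1 : (∑ p ∈ Finset.range m, adjImbalance c ε m A p (h + h)) ^ 2 ≤
      m * ∑ p ∈ Finset.range m, (adjImbalance c ε m A p (h + h)) ^ 2 := by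
    simpa using sq_sum_le_card_mul_sum_sq (s := Finset.range m)
      (f := fun p => adjImbalance c ε m A p (h + h))
  have e2 := Finset.sum_le_sum (s := Finset.range m)
    (fun p _ => aux_gain c ε m A p h hh)
  have e3 := aux_shift m (fun p => potential c ε m A p h) (by
    intro p
    simp only [potential, IsLive, blockDensity, aux_count_per]
    split_ifs with hx <;> simp [hx]) h
  rw [Finset.sum_sub_distrib, ← Finset.sum_div, ← Finset.sum_div, Finset.sum_add_distrib] at e2
  try simp only at e3
  rw [e3] at e2
  unfold DeltaAvg
  rw [div_pow, ← sub_div, div_le_div_iff₀ (by positivity) hm']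
  nlinarith [mul_le_mul_of_nonneg_left e1 hm'.le, mul_le_mul_of_nonneg_left e2 (sq_nonneg (m : ℝ))]

theorem statement10 :
    ∃ c₀ : ℝ, 1 ≤ c₀ ∧
      ∀ c : ℝ, c₀ ≤ c → ∃ C : ℝ, 0 < C ∧
      ∀ m : ℕ, 16 ≤ m → ∀ n : ℕ, n ≤ m →
      0 < 1 - (n : ℝ) / m → 1 - (n : ℝ) / m ≤ 1 / c →
      ∀ A : Fin m → Bool, (Finset.univ.filter (fun i => A i = true)).card = n →
      ∑ j ∈ Jset m, (DeltaAvg c (1 - (n : ℝ) / m) m A j) ^ 2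
        ≤ C * (1 - (n : ℝ) / m) ^ 2 := by
  refine ⟨1, le_rfl, fun c hc => ⟨16 * c ^ 2, by positivity, ?_⟩⟩
  intro m hm n _ _ _ A _
  generalize 1 - (n : ℝ) / m = ε
  have hm' : (0 : ℝ) < m := by exact_mod_cast (by omega : 0 < m)
  unfold Jset
  rw [Finset.sum_image (fun a _ b _ hab => Nat.pow_right_injective le_rfl hab)]
  have key : ∀ L : ℕ, ∑ i ∈ Finset.Icc 1 L, (DeltaAvg c ε m A (2 ^ i)) ^ 2 ≤
      16 * (∑ p ∈ Finset.range m, potential c ε m A p 1) / m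
        - 16 * (∑ p ∈ Finset.range m, potential c ε m A p (2 ^ L)) / m := by
    intro L
    induction L with
    | zero => simp
    | succ L ih =>
      rw [Finset.sum_Icc_succ_top (by omega)]
      have := aux_step c ε m (by omega) A (2 ^ L) (by positivity)
      rw [← two_mul, ← pow_succ'] at this
      linarith
  have h0 : ∑ p ∈ Finset.range m, potential c ε m A p 1 ≤ m * (c * ε) ^ 2 := by
    have := Finset.sum_le_sum (s := Finset.range m) (fun p _ => aux_pot_le c ε m A p)
    simpa using this
  have h1 : 0 ≤ 16 * (∑ p ∈ Finset.range m, potential c ε m A p (2 ^ (Nat.log 2 m - 2))) / m := by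
    have := Finset.sum_nonneg (s := Finset.range m)
      (fun p _ => aux_pot_nonneg c ε m A p (2 ^ (Nat.log 2 m - 2)))
    positivity
  have h2 : 16 * (∑ p ∈ Finset.range m, potential c ε m A p 1) / m ≤ 16 * c ^ 2 * ε ^ 2 := by
    rw [div_le_iff₀ hm']
    nlinarith
  exact (key _).trans (by linarith)
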